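/- arXiv:0801.2960 — 2 statements merged into one kernel-verified Lean document; each statement's English description precedes it below -/
import Mathlib

section
/- Consider two split sequences of the same length n on ℝ^{2N}: {A_i : E_i^1 ⊕ E_i^2 → E_{i+1}^1 ⊕ E_{i+1}^2}_{0 ≤ i < n} and {B_i : F_i^1 ⊕ F_i^2 → F_{i+1}^1 ⊕ F_{i+1}^2}_{0 ≤ i < n}. Assume there are symplectic linear maps C_0, …, C_n : ℝ^{2N} → ℝ^{2N} such that C_{i+1} ∘ A_i = B_i ∘ C_i for 0 ≤ i < n and C_i(E_i^*) = F_i^* for * = 1,2 and 0 ≤ i ≤ n. Let K = max_i ‖C_i‖. If the split sequence {A_i, E_i^{1,2}} is (ε,κ)-flexible, then the split sequence {B_i, F_i^{1,2}} is (K²ε, κ)-flexible. -/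
noncomputable section

open MeasureTheory

/-- The standard symplectic form `ω = Σᵢ dpᵢ ∧ dqᵢ` on `ℝ^{2N}`, where the
coordinates `p₁,…,p_N` occupy the first `N` indices and `q₁,…,q_N` the last `N`. -/
def stdSymp (N : ℕ) (v w : EuclideanSpace ℝ (Fin (N + N))) : ℝ :=
  ∑ i : Fin N,
    (v (Fin.castAdd N i) * w (Fin.natAdd N i) - v (Fin.natAdd N i) * w (Fin.castAdd N i))

/-- `chain g n = g (n-1) ∘ ⋯ ∘ g 0` (the identity for `n = 0`). -/
def chain {α : Type*} (g : ℕ → α → α) : ℕ → α → α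
  | 0 => id
  | n + 1 => g n ∘ chain g n

/-- A symplectomorphism of `ℝ^{2N}`: a `C¹` diffeomorphism whose derivative is
everywhere symplectic. -/
def IsSymplectomorph (N : ℕ) (g : EuclideanSpace ℝ (Fin (N + N)) → EuclideanSpace ℝ (Fin (N + N))) : Prop :=
  Function.Bijective g ∧ ContDiff ℝ 1 g ∧ ContDiff ℝ 1 (Function.invFun g) ∧
    ∀ x v w, stdSymp N (fderiv ℝ g x v) (fderiv ℝ g x w) = stdSymp N v w

/-- A split sequence of length `n` on `ℝ^{2N}`: symplectic linear maps
`A 0, …, A (n-1)` together with invariant splittings `ℝ^{2N} = E1 i ⊕ E2 i`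
(`0 ≤ i ≤ n`) into nonzero subspaces. -/
def IsSplitSeq (N n : ℕ)
    (A : ℕ → EuclideanSpace ℝ (Fin (N + N)) ≃ₗ[ℝ] EuclideanSpace ℝ (Fin (N + N)))
    (E1 E2 : ℕ → Submodule ℝ (EuclideanSpace ℝ (Fin (N + N)))) : Prop :=
  (∀ i < n, ∀ v w, stdSymp N (A i v) (A i w) = stdSymp N v w) ∧
  (∀ i ≤ n, IsCompl (E1 i) (E2 i) ∧ E1 i ≠ ⊥ ∧ E2 i ≠ ⊥) ∧
  (∀ i < n, (E1 i).map (A i : EuclideanSpace ℝ (Fin (N + N)) →ₗ[ℝ] EuclideanSpace ℝ (Fin (N + N))) = E1 (i + 1) ∧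
            (E2 i).map (A i : EuclideanSpace ℝ (Fin (N + N)) →ₗ[ℝ] EuclideanSpace ℝ (Fin (N + N))) = E2 (i + 1))

/-- The angle `∠(E,F) ∈ [0,π/2]` between subspaces: the infimum of the angles
`∠(v,w)` over nonzero `v ∈ E`, `w ∈ F`.  (The set over which the infimum is taken
is augmented by `π/2`; since for nonzero subspaces the infimum of the angles is
always `≤ π/2`, this does not change its value, while it makes the angle equal to
the junk value `π/2` when one of the subspaces is trivial.) -/
def subAngle {V : Type*} [NormedAddCommGroup V] [InnerProductSpace ℝ V]
    (E F : Submodule ℝ V) : ℝ :=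
  sInf ({Real.pi / 2} ∪
    {θ : ℝ | ∃ v ∈ E, v ≠ 0 ∧ ∃ w ∈ F, w ≠ 0 ∧ θ = InnerProductGeometry.angle v w})

/-- The conditions (1)–(3) in the definition of `(ε,κ)`-flexibility, for a fixed
open set `U` and a fixed `γ > 0`: there are symplectomorphisms `g 0, …, g (n-1)`
of `ℝ^{2N}` such that (1) `g i` equals `A i` outside `A (i-1) ∘ ⋯ ∘ A 0 (U)`;
(2) `‖D((A i)⁻¹ ∘ g i)(x) − Id‖ < ε` everywhere; (3) there is a measurable
`G ⊆ U` with `μ(G) > (1−κ) μ(U)` on which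
`∠(D(g (n-1) ∘ ⋯ ∘ g 0)(x)·E1 0, E2 n) < γ`. -/
def FlexWitness (N n : ℕ)
    (A : ℕ → EuclideanSpace ℝ (Fin (N + N)) ≃ₗ[ℝ] EuclideanSpace ℝ (Fin (N + N)))
    (E1 E2 : ℕ → Submodule ℝ (EuclideanSpace ℝ (Fin (N + N))))
    (ε κ : ℝ) (U : Set (EuclideanSpace ℝ (Fin (N + N)))) (γ : ℝ) : Prop :=
  ∃ g : ℕ → EuclideanSpace ℝ (Fin (N + N)) → EuclideanSpace ℝ (Fin (N + N)),
    (∀ i < n, IsSymplectomorph N (g i)) ∧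
    (∀ i < n, ∀ x ∉ chain (fun j => (A j : EuclideanSpace ℝ (Fin (N + N)) →
        EuclideanSpace ℝ (Fin (N + N)))) i '' U, g i x = A i x) ∧
    (∀ i < n, ∀ x, ‖fderiv ℝ (fun y => (A i).symm (g i y)) x
        - ContinuousLinearMap.id ℝ (EuclideanSpace ℝ (Fin (N + N)))‖ < ε) ∧
    ∃ G : Set (EuclideanSpace ℝ (Fin (N + N))), G ⊆ U ∧ MeasurableSet G ∧
      ENNReal.ofReal (1 - κ) * volume U < volume G ∧
      ∀ x ∈ G, subAngle ((E1 0).map (fderiv ℝ (chain g n) x :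
        EuclideanSpace ℝ (Fin (N + N)) →ₗ[ℝ] EuclideanSpace ℝ (Fin (N + N)))) (E2 n) < γ

/-- `(ε,κ)`-flexibility of a split sequence: for every `γ > 0` there is a bounded
open neighborhood `U` of `0` for which the conditions (1)–(3) hold. -/
def IsFlexible (N n : ℕ)
    (A : ℕ → EuclideanSpace ℝ (Fin (N + N)) ≃ₗ[ℝ] EuclideanSpace ℝ (Fin (N + N)))
    (E1 E2 : ℕ → Submodule ℝ (EuclideanSpace ℝ (Fin (N + N))))
    (ε κ : ℝ) : Prop :=
  ∀ γ > (0:ℝ), ∃ U : Set (EuclideanSpace ℝ (Fin (N + N))),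
    IsOpen U ∧ Bornology.IsBounded U ∧ (0 : EuclideanSpace ℝ (Fin (N + N))) ∈ U ∧
    FlexWitness N n A E1 E2 ε κ U γ

open scoped RealInnerProductSpace

/-- The linear complex structure `J` with `⟪J v, w⟫ = ω(v, w)`. -/
def sympJ (N : ℕ) (v : EuclideanSpace ℝ (Fin (N + N))) : EuclideanSpace ℝ (Fin (N + N)) :=
  WithLp.toLp 2 (Fin.addCases (fun i => -v (Fin.natAdd N i)) (fun i => v (Fin.castAdd N i)))

lemma inner_sympJ (N : ℕ) (v w : EuclideanSpace ℝ (Fin (N + N))) :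
    ⟪sympJ N v, w⟫ = stdSymp N v w := by
  simp only [PiLp.inner_apply, Fin.sum_univ_add, sympJ, stdSymp, Fin.addCases_left,
    Fin.addCases_right, RCLike.inner_apply, conj_trivial, ← Finset.sum_add_distrib]
  exact Finset.sum_congr rfl fun i _ => by ring

lemma norm_sympJ (N : ℕ) (v : EuclideanSpace ℝ (Fin (N + N))) : ‖sympJ N v‖ = ‖v‖ := by
  simp only [EuclideanSpace.norm_eq, Fin.sum_univ_add, sympJ, Fin.addCases_left,
    Fin.addCases_right, norm_neg]
  rw [add_comm]

/-- A bound for a symplectic linear map also bounds its inverse. -/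
lemma norm_le_of_symplectic {N : ℕ}
    {C : EuclideanSpace ℝ (Fin (N + N)) → EuclideanSpace ℝ (Fin (N + N))}
    (hC : ∀ v w, stdSymp N (C v) (C w) = stdSymp N v w)
    {K : ℝ} (hK : ∀ v, ‖C v‖ ≤ K * ‖v‖) (v : EuclideanSpace ℝ (Fin (N + N))) :
    ‖v‖ ≤ K * ‖C v‖ := by
  rcases eq_or_ne v 0 with rfl | hv
  · have h0 := hK 0
    simp only [norm_zero, mul_zero] at h0 ⊢
    simp [le_antisymm h0 (norm_nonneg _)]
  have hpos : 0 < ‖v‖ := norm_pos_iff.2 hv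
  have h1 : ‖v‖ * ‖v‖ = stdSymp N v (sympJ N v) := by
    rw [← inner_sympJ, real_inner_self_eq_norm_mul_norm, norm_sympJ]
  have h2 : stdSymp N (C v) (C (sympJ N v)) ≤ ‖C v‖ * ‖C (sympJ N v)‖ := by
    rw [← inner_sympJ, ← norm_sympJ N (C v)]
    exact real_inner_le_norm _ _
  have h3 := mul_le_mul_of_nonneg_left (hK (sympJ N v)) (norm_nonneg (C v))
  rw [norm_sympJ] at h3
  rw [hC, ← h1] at h2
  exact le_of_mul_le_mul_right (by linarith) hpos

lemma cos_angle_ge {V : Type*} [NormedAddCommGroup V] [InnerProductSpace ℝ V] {x y : V}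
    (hx : x ≠ 0) (hy : y ≠ 0) :
    1 - ‖x - y‖ ^ 2 / (2 * (‖x‖ * ‖y‖)) ≤ Real.cos (InnerProductGeometry.angle x y) := by
  have hx' : 0 < ‖x‖ := norm_pos_iff.2 hx
  have hy' : 0 < ‖y‖ := norm_pos_iff.2 hy
  rw [InnerProductGeometry.cos_angle, sub_le_iff_le_add, div_add_div _ _ (by positivity)
    (by positivity), le_div_iff₀ (by positivity), norm_sub_sq_real]
  nlinarith [mul_nonneg (mul_pos hx' hy').le (sq_nonneg (‖x‖ - ‖y‖))]

lemma norm_sub_le_angle {V : Type*} [NormedAddCommGroup V] [InnerProductSpace ℝ V] {x y : V}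
    (hx : ‖x‖ = 1) (hy : ‖y‖ = 1) : ‖x - y‖ ^ 2 ≤ InnerProductGeometry.angle x y ^ 2 := by
  have h := Real.one_sub_sq_div_two_le_cos (x := InnerProductGeometry.angle x y)
  rw [InnerProductGeometry.cos_angle, hx, hy] at h
  rw [norm_sub_sq_real, hx, hy]
  linarith

/-- Small angles remain small under a linear map with bounded distortion. -/
lemma exists_subAngle_map_lt {V W : Type*} [NormedAddCommGroup V] [InnerProductSpace ℝ V]
    [NormedAddCommGroup W] [InnerProductSpace ℝ W] (C : V →ₗ[ℝ] W) {K : ℝ} (hK0 : 0 < K)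
    (hK : ∀ v, ‖C v‖ ≤ K * ‖v‖) (hK' : ∀ v, ‖v‖ ≤ K * ‖C v‖) {γ : ℝ} (hγ : 0 < γ) :
    ∃ δ > 0, ∀ E F : Submodule ℝ V, subAngle E F < δ → subAngle (E.map C) (F.map C) < γ := by
  set γ' := min γ Real.pi with hγ'
  have hγ'0 : 0 < γ' := lt_min hγ Real.pi_pos
  have hd : 0 < 1 - Real.cos γ' := by
    have := Real.cos_lt_cos_of_nonneg_of_le_pi le_rfl (min_le_right γ Real.pi) hγ'0
    rw [Real.cos_zero] at this
    linarith
  refine ⟨min (Real.pi / 2) (√(1 - Real.cos γ') / K ^ 2), ?_, fun E F h => ?_⟩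
  · exact lt_min (by positivity) (div_pos (Real.sqrt_pos.2 hd) (by positivity))
  obtain ⟨θ, hθ, hlt⟩ := exists_lt_of_csInf_lt (Set.Nonempty.inl (Set.singleton_nonempty _)) h
  rcases hθ with rfl | ⟨v, hv, hv0, w, hw, hw0, rfl⟩
  · exact absurd (hlt.trans_le (min_le_left _ _)) (lt_irrefl _)
  have hvp : 0 < ‖v‖⁻¹ := inv_pos.2 (norm_pos_iff.2 hv0)
  have hwp : 0 < ‖w‖⁻¹ := inv_pos.2 (norm_pos_iff.2 hw0)
  set x := ‖v‖⁻¹ • v with hx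
  set y := ‖w‖⁻¹ • w with hy
  have hx1 : ‖x‖ = 1 := by
    rw [hx, norm_smul, norm_inv, norm_norm, inv_mul_cancel₀ (norm_ne_zero_iff.2 hv0)]
  have hy1 : ‖y‖ = 1 := by
    rw [hy, norm_smul, norm_inv, norm_norm, inv_mul_cancel₀ (norm_ne_zero_iff.2 hw0)]
  have hang : InnerProductGeometry.angle x y = InnerProductGeometry.angle v w := by
    rw [hx, hy, InnerProductGeometry.angle_smul_left_of_pos _ _ hvp,
      InnerProductGeometry.angle_smul_right_of_pos _ _ hwp]
  rw [← hang] at hlt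
  have hCx : 1 ≤ K * ‖C x‖ := hx1 ▸ hK' x
  have hCy : 1 ≤ K * ‖C y‖ := hy1 ▸ hK' y
  have hCx0 : 0 < ‖C x‖ := pos_of_mul_pos_right (zero_lt_one.trans_le hCx) hK0.le
  have hCy0 : 0 < ‖C y‖ := pos_of_mul_pos_right (zero_lt_one.trans_le hCy) hK0.le
  have hsub : ‖C x - C y‖ ^ 2 ≤ K ^ 2 * InnerProductGeometry.angle x y ^ 2 := by
    rw [← map_sub]
    calc ‖C (x - y)‖ ^ 2 ≤ (K * ‖x - y‖) ^ 2 := by gcongr; exact hK _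
      _ = K ^ 2 * ‖x - y‖ ^ 2 := by ring
      _ ≤ _ := by gcongr ?_ * ?_; exact norm_sub_le_angle hx1 hy1
  have hθ2 : K ^ 4 * InnerProductGeometry.angle x y ^ 2 < 1 - Real.cos γ' := by
    have h1 := hlt.trans_le (min_le_right _ _)
    rw [lt_div_iff₀ (by positivity)] at h1
    have h2 := pow_lt_pow_left₀ h1
      (mul_nonneg (InnerProductGeometry.angle_nonneg _ _) (by positivity)) two_ne_zero
    rw [Real.sq_sqrt hd.le] at h2
    linarith
  have hdiv : ‖C x - C y‖ ^ 2 / (2 * (‖C x‖ * ‖C y‖)) < 1 - Real.cos γ' := by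
    rw [div_lt_iff₀ (by positivity)]
    have h1 : 1 ≤ K ^ 2 * (‖C x‖ * ‖C y‖) := by nlinarith
    have h2 : K ^ 2 * InnerProductGeometry.angle x y ^ 2 ≤
        K ^ 4 * InnerProductGeometry.angle x y ^ 2 * (‖C x‖ * ‖C y‖) := by
      have := mul_le_mul_of_nonneg_left h1
        (mul_nonneg (sq_nonneg K) (sq_nonneg (InnerProductGeometry.angle x y)))
      linarith
    have h3 := mul_lt_mul_of_pos_right hθ2 (mul_pos hCx0 hCy0)
    have h4 := mul_pos hd (mul_pos hCx0 hCy0)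
    linarith
  have hcos := cos_angle_ge (norm_pos_iff.1 hCx0) (norm_pos_iff.1 hCy0)
  have hfin : InnerProductGeometry.angle (C x) (C y) < γ' := by
    by_contra! hge
    have := Real.cos_le_cos_of_nonneg_of_le_pi hγ'0.le
      (InnerProductGeometry.angle_le_pi (C x) (C y)) hge
    linarith
  refine lt_of_le_of_lt (csInf_le ⟨0, ?_⟩ (Set.mem_union_right _ ⟨C x, ⟨x, E.smul_mem _ hv, rfl⟩,
    norm_pos_iff.1 hCx0, C y, ⟨y, F.smul_mem _ hw, rfl⟩, norm_pos_iff.1 hCy0, rfl⟩))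
      (hfin.trans_le (min_le_left _ _))
  rintro _ (rfl | ⟨a, -, -, b, -, -, rfl⟩)
  · positivity
  · exact InnerProductGeometry.angle_nonneg _ _

lemma chain_semiconj {α β : Type*} {a : ℕ → α → α} {b : ℕ → β → β} {c : ℕ → α → β} :
    ∀ {n : ℕ}, (∀ i < n, ∀ x, c (i + 1) (a i x) = b i (c i x)) →
      ∀ x, c n (chain a n x) = chain b n (c 0 x)
  | 0, _, _ => rfl
  | n + 1, h, x => by
    have ih := chain_semiconj (n := n) (fun i hi => h i (hi.trans n.lt_succ_self)) x
    simp only [chain, Function.comp_apply, h n n.lt_succ_self, ih]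

/-- Conjugating a symplectomorphism by symplectic linear maps gives a symplectomorphism. -/
lemma IsSymplectomorph.conj {N : ℕ}
    {g : EuclideanSpace ℝ (Fin (N + N)) → EuclideanSpace ℝ (Fin (N + N))}
    (hg : IsSymplectomorph N g)
    (C D : EuclideanSpace ℝ (Fin (N + N)) ≃L[ℝ] EuclideanSpace ℝ (Fin (N + N)))
    (hC : ∀ v w, stdSymp N (C v) (C w) = stdSymp N v w)
    (hD : ∀ v w, stdSymp N (D v) (D w) = stdSymp N v w) :
    IsSymplectomorph N (D ∘ g ∘ C.symm) := by
  obtain ⟨hbij, hsm, hinv, hsymp⟩ := hg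
  have hbij' : Function.Bijective (D ∘ g ∘ C.symm) :=
    D.bijective.comp (hbij.comp C.symm.bijective)
  refine ⟨hbij', D.contDiff.comp (hsm.comp C.symm.contDiff), ?_, fun x v w => ?_⟩
  · have : Function.invFun (D ∘ g ∘ C.symm) = C ∘ Function.invFun g ∘ D.symm := by
      funext y
      apply hbij'.injective
      rw [Function.rightInverse_invFun hbij'.surjective y]
      simp [Function.rightInverse_invFun hbij.surjective _]
    rw [this]
    exact C.contDiff.comp (hinv.comp D.symm.contDiff)
  · rw [D.comp_fderiv, C.symm.comp_right_fderiv]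
    simp only [ContinuousLinearMap.comp_apply, ContinuousLinearEquiv.coe_coe, hD, hsymp]
    simpa using (hC (C.symm v) (C.symm w)).symm

lemma norm_conj_sub_id_le {V : Type*} [NormedAddCommGroup V] [NormedSpace ℝ V] (L : V ≃L[ℝ] V)
    (M : V →L[ℝ] V) {K : ℝ} (hK0 : 0 ≤ K) (hK : ∀ v, ‖L v‖ ≤ K * ‖v‖)
    (hK' : ∀ v, ‖v‖ ≤ K * ‖L v‖) :
    ‖(L : V →L[ℝ] V).comp (M.comp (L.symm : V →L[ℝ] V)) - ContinuousLinearMap.id ℝ V‖ ≤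
      K ^ 2 * ‖M - ContinuousLinearMap.id ℝ V‖ := by
  refine ContinuousLinearMap.opNorm_le_bound _ (by positivity) fun v => ?_
  obtain ⟨u, rfl⟩ := L.surjective v
  calc _ = ‖L ((M - ContinuousLinearMap.id ℝ V) u)‖ := by simp
    _ ≤ K * ‖(M - ContinuousLinearMap.id ℝ V) u‖ := hK _
    _ ≤ K * (‖M - ContinuousLinearMap.id ℝ V‖ * (K * ‖L u‖)) := by
      gcongr
      exact (ContinuousLinearMap.le_opNorm _ u).trans (by gcongr; exact hK' u)
    _ = _ := by ring

/-- Flexibility is preserved by symplectic changes of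
coordinates: if `C i` are symplectic linear maps with `C (i+1) ∘ A i = B i ∘ C i`
and `C i (E* i) = F* i`, and `K` bounds the norms `‖C i‖`, then
`(ε,κ)`-flexibility of `{A i, E1 i, E2 i}` implies `(K²ε,κ)`-flexibility of
`{B i, F1 i, F2 i}`. -/
theorem stmt_12 (N n : ℕ) (hN : 0 < N)
    (A B : ℕ → EuclideanSpace ℝ (Fin (N + N)) ≃ₗ[ℝ] EuclideanSpace ℝ (Fin (N + N)))
    (E1 E2 F1 F2 : ℕ → Submodule ℝ (EuclideanSpace ℝ (Fin (N + N))))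
    (hA : IsSplitSeq N n A E1 E2) (hB : IsSplitSeq N n B F1 F2)
    (C : ℕ → EuclideanSpace ℝ (Fin (N + N)) ≃ₗ[ℝ] EuclideanSpace ℝ (Fin (N + N)))
    (hCsymp : ∀ i ≤ n, ∀ v w, stdSymp N (C i v) (C i w) = stdSymp N v w)
    (hconj : ∀ i < n, ∀ v, C (i + 1) (A i v) = B i (C i v))
    (hmap1 : ∀ i ≤ n, (E1 i).map (C i : EuclideanSpace ℝ (Fin (N + N)) →ₗ[ℝ]
      EuclideanSpace ℝ (Fin (N + N))) = F1 i)
    (hmap2 : ∀ i ≤ n, (E2 i).map (C i : EuclideanSpace ℝ (Fin (N + N)) →ₗ[ℝ]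
      EuclideanSpace ℝ (Fin (N + N))) = F2 i)
    (K : ℝ) (hK : ∀ i ≤ n, ∀ v, ‖C i v‖ ≤ K * ‖v‖)
    (ε κ : ℝ) (hε : 0 < ε) (hκ : 0 < κ)
    (hflex : IsFlexible N n A E1 E2 ε κ) :
    IsFlexible N n B F1 F2 (K ^ 2 * ε) κ := by
  have hK' : ∀ i ≤ n, ∀ v, ‖v‖ ≤ K * ‖C i v‖ := fun i hi =>
    norm_le_of_symplectic (hCsymp i hi) (hK i hi)
  have hK0 : 0 < K := by
    have h := hK' 0 n.zero_le (EuclideanSpace.single (Fin.castAdd N ⟨0, hN⟩) 1)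
    rw [PiLp.norm_single, norm_one] at h
    exact pos_of_mul_pos_left (zero_lt_one.trans_le h) (norm_nonneg _)
  let L := fun i => (C i).toContinuousLinearEquiv
  intro γ hγ
  obtain ⟨δ, hδ, hangle⟩ := exists_subAngle_map_lt (C n).toLinearMap hK0 (hK n le_rfl)
    (hK' n le_rfl) hγ
  obtain ⟨U, hUo, hUb, hU0, g, hg, hgA, hgε, G, hGU, hGm, hGμ, hGγ⟩ := hflex δ hδ
  have hconjg : ∀ i, ∀ x, L (i + 1) (g i x) = (L (i + 1) ∘ g i ∘ (L i).symm) (L i x) := by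
    simp
  have hBsymm : ∀ i < n, ∀ y, (B i).symm (C (i + 1) y) = C i ((A i).symm y) := fun i hi y => by
    rw [LinearEquiv.symm_apply_eq, ← hconj i hi, LinearEquiv.apply_symm_apply]
  refine ⟨L 0 '' U, (L 0).isOpenMap _ hUo, ?_, ⟨0, hU0, map_zero _⟩,
    fun i => L (i + 1) ∘ g i ∘ (L i).symm, fun i hi => ?_, fun i hi x hx => ?_,
    fun i hi x => ?_, L 0 '' G, Set.image_mono hGU, ?_, ?_, ?_⟩
  · exact (L 0).lipschitz.isBounded_image hUb
  · exact (hg i hi).conj _ _ (hCsymp i hi.le) (hCsymp (i + 1) hi)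
  · obtain ⟨y, rfl⟩ := (L i).surjective x
    refine (hconjg i y).symm.trans ?_
    rw [hgA i hi y]
    · exact hconj i hi y
    · rintro ⟨u, hu, rfl⟩
      exact hx ⟨L 0 u, ⟨u, hu, rfl⟩, (chain_semiconj (c := fun i => L i)
        (fun j hj => hconj j (hj.trans hi)) u).symm⟩
  · have heq : (fun y => (B i).symm ((L (i + 1) ∘ g i ∘ (L i).symm) y)) =
        L i ∘ (fun y => (A i).symm (g i y)) ∘ (L i).symm := by
      funext y
      exact hBsymm i hi _
    rw [heq, (L i).comp_fderiv, (L i).symm.comp_right_fderiv]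
    exact (norm_conj_sub_id_le (L i) _ hK0.le (hK i hi.le) (hK' i hi.le)).trans_lt
      (mul_lt_mul_of_pos_left (hgε i hi _) (by positivity))
  · exact (L 0).toHomeomorph.measurableEmbedding.measurableSet_image.2 hGm
  · rw [Measure.addHaar_image_continuousLinearEquiv, Measure.addHaar_image_continuousLinearEquiv,
      mul_left_comm]
    refine (ENNReal.mul_lt_mul_iff_right ?_ ENNReal.ofReal_ne_top).2 hGμ
    exact (ENNReal.ofReal_pos.2 (abs_pos.2 (LinearEquiv.isUnit_det' (C 0)).ne_zero)).ne'
  · rintro _ ⟨x, hx, rfl⟩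
    have hch : chain (fun i => L (i + 1) ∘ g i ∘ (L i).symm) n =
        L n ∘ chain g n ∘ (L 0).symm := by
      funext y
      obtain ⟨u, rfl⟩ := (L 0).surjective y
      have := chain_semiconj (n := n) (c := fun i => L i) (fun j _ => hconjg j) u
      simpa using this.symm
    rw [hch, (L n).comp_fderiv, (L 0).symm.comp_right_fderiv, ContinuousLinearEquiv.symm_apply_apply]
    convert hangle _ _ (hGγ x hx) using 2
    · rw [← hmap1 0 n.zero_le, ← Submodule.map_comp, ← Submodule.map_comp]
      congr 1
      ext1 v
      simp [L]
    · exact (hmap2 n le_rfl).symm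
end
end

section
/- Assume {A_i, E_i^{1,2}} is an (ε, κ/2)-flexible split sequence of length n on ℝ^{2N}. Then for ANY nonempty bounded open set U ⊂ ℝ^{2N} and any γ > 0, there exist symplectomorphisms g_0, …, g_{n−1} of ℝ^{2N} satisfying the three conditions in the definition of (ε,κ)-flexibility with this set U and this γ; namely: (1) g_i equals A_i outside A_{i−1}∘⋯∘A_0(U) for each i; (2) ‖D(A_i^{−1}∘g_i)(x) − Id‖ < ε for every x and every i; (3) there is a measurable set G ⊂ U with μ(G) > (1−κ)μ(U) such that ∠(D(g_{n−1}∘⋯∘g_0)(x)·E_0^1, E_n^2) < γ for all x ∈ G. -/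
noncomputable section

open MeasureTheory

open Set Filter Topology Metric

/-- The phase space `ℝ^{2N}`. -/
abbrev PhaseSpace (N : ℕ) : Type := EuclideanSpace ℝ (Fin (N + N))

namespace IsSymplectomorph

variable {N : ℕ} {f g : PhaseSpace N → PhaseSpace N}

theorem of_inverse (hl : Function.LeftInverse g f) (hr : Function.RightInverse g f)
    (hf : ContDiff ℝ 1 f) (hg : ContDiff ℝ 1 g)
    (hs : ∀ x v w, stdSymp N (fderiv ℝ f x v) (fderiv ℝ f x w) = stdSymp N v w) :
    IsSymplectomorph N f := by
  have hb : Function.Bijective f := ⟨hl.injective, hr.surjective⟩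
  refine ⟨hb, hf, ?_, hs⟩
  have : Function.invFun f = g :=
    funext fun x => hl.injective <| by
      rw [Function.rightInverse_invFun hb.2 x, hr x]
  rwa [this]

theorem leftInverse (hf : IsSymplectomorph N f) :
    Function.LeftInverse (Function.invFun f) f :=
  Function.leftInverse_invFun hf.1.1

theorem rightInverse (hf : IsSymplectomorph N f) :
    Function.RightInverse (Function.invFun f) f :=
  Function.rightInverse_invFun hf.1.2

theorem differentiableAt (hf : IsSymplectomorph N f) (x : PhaseSpace N) :
    DifferentiableAt ℝ f x :=
  (hf.2.1.differentiable one_ne_zero) x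

theorem differentiableAt_invFun (hf : IsSymplectomorph N f) (x : PhaseSpace N) :
    DifferentiableAt ℝ (Function.invFun f) x :=
  (hf.2.2.1.differentiable one_ne_zero) x

theorem fderiv_invFun_mul (hf : IsSymplectomorph N f) (x : PhaseSpace N) :
    fderiv ℝ (Function.invFun f) (f x) * fderiv ℝ f x = 1 := by
  have h := fderiv_comp x (hf.differentiableAt_invFun (f x)) (hf.differentiableAt x)
  rw [hf.leftInverse.comp_eq_id, fderiv_id] at h
  exact h.symm

theorem mul_fderiv_invFun (hf : IsSymplectomorph N f) (x : PhaseSpace N) :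
    fderiv ℝ f x * fderiv ℝ (Function.invFun f) (f x) = 1 := by
  have h := fderiv_comp (f x) (hf.differentiableAt (Function.invFun f (f x)))
    (hf.differentiableAt_invFun (f x))
  rw [hf.rightInverse.comp_eq_id, fderiv_id, hf.leftInverse x] at h
  exact h.symm

theorem isUnit_fderiv (hf : IsSymplectomorph N f) (x : PhaseSpace N) :
    IsUnit (fderiv ℝ f x) :=
  ⟨⟨_, _, hf.mul_fderiv_invFun x, hf.fderiv_invFun_mul x⟩, rfl⟩

theorem inverse_fderiv (hf : IsSymplectomorph N f) (x : PhaseSpace N) :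
    Ring.inverse (fderiv ℝ f x) = fderiv ℝ (Function.invFun f) (f x) :=
  Ring.inverse_unit ⟨_, _, hf.mul_fderiv_invFun x, hf.fderiv_invFun_mul x⟩

theorem comp (hg : IsSymplectomorph N g) (hf : IsSymplectomorph N f) :
    IsSymplectomorph N (g ∘ f) := by
  refine of_inverse (g := Function.invFun f ∘ Function.invFun g)
    (hg.leftInverse.comp hf.leftInverse)
    (hg.rightInverse.comp hf.rightInverse) (hg.2.1.comp hf.2.1) (hf.2.2.1.comp hg.2.2.1) ?_
  intro x v w
  rw [fderiv_comp x (hg.differentiableAt _) (hf.differentiableAt _)]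
  simp only [ContinuousLinearMap.comp_apply]
  rw [hg.2.2.2, hf.2.2.2]

theorem invFun (hf : IsSymplectomorph N f) : IsSymplectomorph N (Function.invFun f) := by
  refine of_inverse hf.rightInverse hf.leftInverse hf.2.2.1 hf.2.1 ?_
  intro x v w
  obtain ⟨y, rfl⟩ := hf.1.2 x
  have h := hf.mul_fderiv_invFun y
  rw [← hf.2.2.2 y]
  simp only [← mul_apply_eq_comp, h, one_apply_eq_self]

protected theorem id : IsSymplectomorph N (id : PhaseSpace N → PhaseSpace N) :=
  of_inverse (g := id) (fun _ => rfl) (fun _ => rfl) contDiff_id contDiff_id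
    (fun x v w => by simp)

theorem of_linearEquiv (A : PhaseSpace N ≃ₗ[ℝ] PhaseSpace N)
    (hA : ∀ v w, stdSymp N (A v) (A w) = stdSymp N v w) : IsSymplectomorph N A := by
  refine of_inverse (g := A.symm) A.symm_apply_apply A.apply_symm_apply
    A.toContinuousLinearEquiv.contDiff A.symm.toContinuousLinearEquiv.contDiff ?_
  intro x v w
  have : fderiv ℝ A x = (A.toContinuousLinearEquiv : PhaseSpace N →L[ℝ] PhaseSpace N) :=
    A.toContinuousLinearEquiv.fderiv
  rw [this]
  exact hA v w

end IsSymplectomorph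

/-- The conjugate of `f` by the homothety `y ↦ a + ρ • y`. -/
def rescale {N : ℕ} (a : PhaseSpace N) (ρ : ℝ) (f : PhaseSpace N → PhaseSpace N) :
    PhaseSpace N → PhaseSpace N :=
  fun x => a + ρ • f (ρ⁻¹ • (x - a))

/-- The image of `T` under the homothety `y ↦ a + ρ • y`, for `ρ ≠ 0`. -/
def rescaleSet {N : ℕ} (a : PhaseSpace N) (ρ : ℝ) (T : Set (PhaseSpace N)) :
    Set (PhaseSpace N) :=
  {x | ρ⁻¹ • (x - a) ∈ T}

section rescale

variable {N : ℕ} {f g : PhaseSpace N → PhaseSpace N}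

theorem rescale_id (a : PhaseSpace N) {ρ : ℝ} (hρ : ρ ≠ 0) :
    rescale a ρ (id : PhaseSpace N → PhaseSpace N) = id := by
  funext x
  simp [rescale, smul_smul, hρ]

theorem rescale_eq_self {a : PhaseSpace N} {ρ : ℝ} (hρ : ρ ≠ 0) {x : PhaseSpace N}
    (h : f (ρ⁻¹ • (x - a)) = ρ⁻¹ • (x - a)) : rescale a ρ f x = x := by
  simp [rescale, h, smul_smul, hρ]

theorem Function.LeftInverse.rescale (h : Function.LeftInverse g f) (a : PhaseSpace N) {ρ : ℝ}
    (hρ : ρ ≠ 0) : Function.LeftInverse (rescale a ρ g) (rescale a ρ f) := by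
  intro x
  simp [_root_.rescale, smul_smul, hρ, h _]

theorem ContDiff.rescale (hf : ContDiff ℝ 1 f) (a : PhaseSpace N) (ρ : ℝ) :
    ContDiff ℝ 1 (rescale a ρ f) :=
  contDiff_const.add ((hf.comp ((contDiff_id.sub contDiff_const).const_smul ρ⁻¹)).const_smul ρ)

theorem fderiv_rescale (hf : Differentiable ℝ f) (a : PhaseSpace N) {ρ : ℝ} (hρ : ρ ≠ 0)
    (x : PhaseSpace N) :
    fderiv ℝ (rescale a ρ f) x = fderiv ℝ f (ρ⁻¹ • (x - a)) := by
  have h1 : HasFDerivAt (fun x : PhaseSpace N => ρ⁻¹ • (x - a))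
      (ρ⁻¹ • ContinuousLinearMap.id ℝ (PhaseSpace N)) x :=
    ((hasFDerivAt_id x).sub_const a).const_smul ρ⁻¹
  have h2 := (((hf (ρ⁻¹ • (x - a))).hasFDerivAt.comp x h1).const_smul ρ).const_add a
  have h3 : HasFDerivAt (rescale a ρ f) _ x := h2
  rw [h3.fderiv]
  ext v
  simp [smul_smul, hρ]

theorem IsSymplectomorph.rescale (hf : IsSymplectomorph N f) (a : PhaseSpace N) {ρ : ℝ}
    (hρ : ρ ≠ 0) : IsSymplectomorph N (rescale a ρ f) := by
  refine of_inverse (hf.leftInverse.rescale a hρ)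
    (Function.LeftInverse.rescale hf.rightInverse a hρ) (hf.2.1.rescale a ρ)
    (hf.2.2.1.rescale a ρ) ?_
  intro x v w
  rw [fderiv_rescale hf.differentiableAt a hρ]
  exact hf.2.2.2 _ v w

theorem measurableSet_rescaleSet {T : Set (PhaseSpace N)} (hT : MeasurableSet T)
    (a : PhaseSpace N) (ρ : ℝ) : MeasurableSet (rescaleSet a ρ T) :=
  (show Continuous fun x : PhaseSpace N => ρ⁻¹ • (x - a) by fun_prop).measurable hT

theorem volume_real_rescaleSet (T : Set (PhaseSpace N)) (a : PhaseSpace N) {ρ : ℝ}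
    (hρ : 0 < ρ) :
    volume.real (rescaleSet a ρ T) = ρ ^ (N + N) * volume.real T := by
  have h1 : rescaleSet a ρ T = (fun x => x + -a) ⁻¹' ((ρ⁻¹ • ·) ⁻¹' T) := by
    ext x
    simp [rescaleSet, sub_eq_add_neg]
  rw [h1, measureReal_def, measure_preimage_add_right,
    Measure.addHaar_preimage_smul _ (inv_ne_zero hρ.ne'), ENNReal.toReal_mul, measureReal_def,
    ENNReal.toReal_ofReal (abs_nonneg _), finrank_euclideanSpace_fin, inv_pow, inv_inv,
    abs_of_pos (pow_pos hρ _)]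

theorem rescaleSet_closedBall (a : PhaseSpace N) {ρ : ℝ} (hρ : 0 < ρ) (R : ℝ) :
    rescaleSet a ρ (closedBall 0 R) = closedBall a (ρ * R) := by
  ext x
  change dist (ρ⁻¹ • (x - a)) 0 ≤ R ↔ dist x a ≤ ρ * R
  rw [dist_zero_right, norm_smul, norm_inv, Real.norm_of_nonneg hρ.le, dist_eq_norm,
    inv_mul_le_iff₀ hρ]

end rescale

/-- A bounded open set contains finitely many disjoint closed balls covering half of its
volume. -/
theorem exists_finset_closedBall_half_volume {N : ℕ} {W : Set (PhaseSpace N)} (hW : IsOpen W)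
    (hWfin : volume W ≠ ⊤) :
    ∃ (S : Finset (PhaseSpace N)) (r : PhaseSpace N → ℝ),
      (∀ x ∈ S, 0 < r x ∧ closedBall x (r x) ⊆ W) ∧
      (S : Set (PhaseSpace N)).PairwiseDisjoint (fun x => closedBall x (r x)) ∧
      volume.real W / 2 ≤ ∑ x ∈ S, volume.real (closedBall x (r x)) := by
  have hR : ∀ x ∈ W, ∃ R > 0, closedBall x R ⊆ W := fun x hx =>
    nhds_basis_closedBall.mem_iff.1 (hW.mem_nhds hx)
  choose! R hR0 hRW using hR
  obtain ⟨t, r, htc, htW, htr, hcov, hdisj⟩ :=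
    Besicovitch.exists_disjoint_closedBall_covering_ae (volume : Measure (PhaseSpace N))
      (fun _ => Ioi 0) W (fun x _ δ hδ => ⟨δ / 2, by simp [hδ]⟩) R hR0
  have hsub : ∀ x ∈ t, closedBall x (r x) ⊆ W := fun x hx =>
    (closedBall_subset_closedBall (htr x hx).2.2.le).trans (hRW x (htW hx))
  rcases eq_or_ne (volume W) 0 with h0 | h0
  · exact ⟨∅, r, by simp, by simp, by simp [measureReal_def, h0]⟩
  have hle : volume W ≤ ∑' x : t, volume (closedBall (x : PhaseSpace N) (r x)) := by
    rw [← measure_biUnion htc hdisj fun x _ => measurableSet_closedBall]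
    calc volume W ≤ volume ((⋃ x ∈ t, closedBall x (r x)) ∪ (W \ ⋃ x ∈ t, closedBall x (r x))) :=
          measure_mono (by rw [union_sdiff_self]; exact subset_union_right)
      _ ≤ _ := (measure_union_le _ _).trans (by rw [hcov, add_zero])
  have hlt : volume W / 2 < ∑' x : t, volume (closedBall (x : PhaseSpace N) (r x)) :=
    (ENNReal.half_lt_self h0 hWfin).trans_le hle
  obtain ⟨s, hs⟩ := (ENNReal.summable.hasSum.eventually (lt_mem_nhds hlt)).exists
  refine ⟨s.map (Function.Embedding.subtype _), r, ?_, ?_, ?_⟩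
  · intro x hx
    obtain ⟨y, -, rfl⟩ := Finset.mem_map.1 hx
    exact ⟨(htr y y.2).2.1, hsub y y.2⟩
  · refine hdisj.subset ?_
    intro x hx
    obtain ⟨y, -, rfl⟩ := Finset.mem_map.1 (Finset.mem_coe.1 hx)
    exact y.2
  · rw [Finset.sum_map]
    have h := ENNReal.toReal_mono
      (ENNReal.sum_lt_top.2 fun x _ => measure_closedBall_lt_top).ne hs.le
    rw [ENNReal.toReal_div, ENNReal.toReal_sum fun x _ => measure_closedBall_lt_top.ne] at h
    simpa [measureReal_def] using h

/-- The derivative of a `C¹` map is almost everywhere the identity on the fixed point set. -/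
theorem ae_fderiv_eq_one_of_fixed {N : ℕ} {f : PhaseSpace N → PhaseSpace N}
    (hf : Differentiable ℝ f) {s : Set (PhaseSpace N)} (hs : MeasurableSet s)
    (hfs : ∀ x ∈ s, f x = x) : ∀ᵐ x, x ∈ s → fderiv ℝ f x = 1 := by
  have h : ApproximatesLinearOn f (1 : PhaseSpace N →L[ℝ] PhaseSpace N) s 0 := by
    intro x hx y hy
    simp [hfs x hx, hfs y hy]
  have h2 := h.norm_fderiv_sub_le volume hs (fderiv ℝ f)
    fun x _ => (hf x).hasFDerivAt.hasFDerivWithinAt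
  rw [ae_restrict_iff' hs] at h2
  filter_upwards [h2] with x hx hxs
  have := hx hxs
  simpa [sub_eq_zero] using this

/-- The sequence of derivatives at `x` of a sequence of maps. -/
def derivSeq {N : ℕ} (Φ : ℕ → PhaseSpace N → PhaseSpace N) (x : PhaseSpace N) :
    ℕ → PhaseSpace N →L[ℝ] PhaseSpace N :=
  fun i => fderiv ℝ (Φ i) x

/-- A sequence of symplectomorphisms, starting with the identity, all of which fix every point
outside `T`. -/
structure IsSympPath (N : ℕ) (T : Set (PhaseSpace N)) (Φ : ℕ → PhaseSpace N → PhaseSpace N) :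
    Prop where
  symp : ∀ i, IsSymplectomorph N (Φ i)
  zero : Φ 0 = id
  eq_self : ∀ i, ∀ x ∉ T, Φ i x = x

namespace IsSympPath

variable {N : ℕ} {T U : Set (PhaseSpace N)} {Φ Ψ : ℕ → PhaseSpace N → PhaseSpace N}

protected theorem id : IsSympPath N T fun _ => id :=
  ⟨fun _ => .id, rfl, fun _ _ _ => rfl⟩

theorem comp (hΦ : IsSympPath N T Φ) (hΨ : IsSympPath N T Ψ) :
    IsSympPath N T fun i => Φ i ∘ Ψ i where
  symp i := (hΦ.symp i).comp (hΨ.symp i)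
  zero := by simp [hΦ.zero, hΨ.zero]
  eq_self i x hx := by simp [hΨ.eq_self i x hx, hΦ.eq_self i x hx]

theorem mono (hΦ : IsSympPath N T Φ) (h : T ⊆ U) : IsSympPath N U Φ :=
  ⟨hΦ.symp, hΦ.zero, fun i x hx => hΦ.eq_self i x fun hT => hx (h hT)⟩

theorem rescale (hΦ : IsSympPath N T Φ) (a : PhaseSpace N) {ρ : ℝ} (hρ : ρ ≠ 0) :
    IsSympPath N (rescaleSet a ρ T) fun i => rescale a ρ (Φ i) where
  symp i := (hΦ.symp i).rescale a hρ
  zero := by rw [hΦ.zero, rescale_id a hρ]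
  eq_self i x hx := rescale_eq_self hρ (hΦ.eq_self i _ hx)

theorem mapsTo (hΦ : IsSympPath N T Φ) (i : ℕ) (h : T ⊆ U) : MapsTo (Φ i) U U := by
  intro x hx
  by_contra hn
  have h1 := (hΦ.mono h).eq_self i _ hn
  rw [(hΦ.symp i).1.1 h1] at hn
  exact hn hx

theorem continuous_derivSeq (hΦ : IsSympPath N T Φ) : Continuous (derivSeq Φ) :=
  continuous_pi fun i => (hΦ.symp i).2.1.continuous_fderiv one_ne_zero

theorem derivSeq_rescale (hΦ : IsSympPath N T Φ) (a : PhaseSpace N) {ρ : ℝ} (hρ : ρ ≠ 0)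
    (x : PhaseSpace N) :
    derivSeq (fun i => _root_.rescale a ρ (Φ i)) x = derivSeq Φ (ρ⁻¹ • (x - a)) :=
  funext fun i => fderiv_rescale (hΦ.symp i).differentiableAt a hρ x

theorem derivSeq_comp (hΦ : IsSympPath N T Φ) (hΨ : IsSympPath N U Ψ) (x : PhaseSpace N) :
    derivSeq (fun i => Φ i ∘ Ψ i) x = (fun i => fderiv ℝ (Φ i) (Ψ i x)) * derivSeq Ψ x :=
  funext fun i => fderiv_comp x ((hΦ.symp i).differentiableAt _) ((hΨ.symp i).differentiableAt x)

/-- Precomposition of `Φ` with finitely many disjoint rescaled copies of `Ψ`. -/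
theorem exists_comp_rescale {R : ℝ} (hΦ : IsSympPath N U Φ) (hΨ : IsSympPath N T Ψ)
    (hTR : T ⊆ closedBall 0 R) (hΨT : ∀ x ∉ T, derivSeq Ψ x = 1)
    (S : Finset (PhaseSpace N)) (ρ : PhaseSpace N → ℝ) (hρ : ∀ a ∈ S, 0 < ρ a)
    (hSU : ∀ a ∈ S, closedBall a (ρ a * R) ⊆ U)
    (hdisj : (S : Set (PhaseSpace N)).PairwiseDisjoint fun a => closedBall a (ρ a * R)) :
    ∃ Φ', IsSympPath N U Φ' ∧
      (∀ x, (∀ a ∈ S, x ∉ rescaleSet a (ρ a) T) → derivSeq Φ' x = derivSeq Φ x) ∧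
      ∀ a ∈ S, ∀ x ∈ closedBall a (ρ a * R), ∃ y : ℕ → PhaseSpace N,
        (∀ i, y i ∈ closedBall a (ρ a * R)) ∧
        derivSeq Φ' x =
          (fun i => fderiv ℝ (Φ i) (y i)) * derivSeq Ψ ((ρ a)⁻¹ • (x - a)) := by
  classical
  induction S using Finset.induction_on with
  | empty => exact ⟨Φ, hΦ, fun _ _ => rfl, by simp⟩
  | insert a S haS ih =>
    obtain ⟨Φ', hΦ', hout, hin⟩ := ih (fun b hb => hρ b (Finset.mem_insert_of_mem hb))
      (fun b hb => hSU b (Finset.mem_insert_of_mem hb))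
      (hdisj.subset (by simp))
    have hρa := hρ a (Finset.mem_insert_self a S)
    have haU := hSU a (Finset.mem_insert_self a S)
    have hball : ∀ b ∈ insert a S, rescaleSet b (ρ b) T ⊆ closedBall b (ρ b * R) := by
      intro b hb
      rw [← rescaleSet_closedBall b (hρ b hb)]
      exact fun x hx => hTR hx
    have haT := hball a (Finset.mem_insert_self a S)
    have hcopy := hΨ.rescale a hρa.ne'
    have hcopy' := hcopy.mono (haT.trans haU)
    have hfix : ∀ x ∉ rescaleSet a (ρ a) T,
        derivSeq (fun i => Φ' i ∘ _root_.rescale a (ρ a) (Ψ i)) x = derivSeq Φ' x := by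
      intro x hx
      rw [hΦ'.derivSeq_comp hcopy, hΨ.derivSeq_rescale a hρa.ne', hΨT _ hx, mul_one]
      funext i
      simp only [hcopy.eq_self i x hx]
      rfl
    have hne : ∀ b ∈ S, ∀ x ∈ closedBall a (ρ a * R), x ∉ closedBall b (ρ b * R) := by
      intro b hb x hx hxb
      exact (disjoint_left.1 (hdisj (by simp) (by simp [hb])
        (fun h : a = b => haS (h ▸ hb)))) hx hxb
    refine ⟨_, hΦ'.comp hcopy', ?_, ?_⟩
    · intro x hx
      rw [hfix x (hx a (Finset.mem_insert_self a S)),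
        hout x fun b hb => hx b (Finset.mem_insert_of_mem hb)]
    · intro b hb x hx
      rcases Finset.mem_insert.1 hb with rfl | hbS
      · refine ⟨fun i => _root_.rescale b (ρ b) (Ψ i) x, fun i => hcopy.mapsTo i haT hx, ?_⟩
        rw [hΦ'.derivSeq_comp hcopy, hΨ.derivSeq_rescale b hρa.ne']
        congr 1
        funext i
        refine congrFun (hout _ fun d hd hmem => ?_) i
        exact hne d hd _ (hcopy.mapsTo i haT hx) (hball d (Finset.mem_insert_of_mem hd) hmem)
      · rw [hfix x fun hxa => hne b hbS x (haT hxa) hx]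
        exact hin b hbS x hx

end IsSympPath

/-- A path `Ψ` supported in `T ⊆ closedBall 0 R`, all of whose derivative sequences lie in `𝒜`,
and in `𝒢` over `G ⊆ T`, robustly under left multiplication by sequences close to `1`. -/
structure IsModelPath (N : ℕ) (𝒜 𝒢 : Set (ℕ → PhaseSpace N →L[ℝ] PhaseSpace N)) (R : ℝ)
    (T G : Set (PhaseSpace N)) (I : Set ℕ) (V : Set (PhaseSpace N →L[ℝ] PhaseSpace N))
    (Ψ : ℕ → PhaseSpace N → PhaseSpace N) : Prop where
  path : IsSympPath N T Ψ
  R_pos : 0 < R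
  subset_closedBall : T ⊆ closedBall 0 R
  measurableSet : MeasurableSet T
  measurableSet_good : MeasurableSet G
  good_subset : G ⊆ T
  derivSeq_eq_one : ∀ x ∉ T, derivSeq Ψ x = 1
  finite : I.Finite
  isOpen : IsOpen V
  one_mem : 1 ∈ V
  mul_mem : ∀ a : ℕ → PhaseSpace N →L[ℝ] PhaseSpace N, (∀ i ∈ I, a i ∈ V) →
    ∀ x, a * derivSeq Ψ x ∈ 𝒜
  mul_mem_good : ∀ a : ℕ → PhaseSpace N →L[ℝ] PhaseSpace N, (∀ i ∈ I, a i ∈ V) →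
    ∀ x ∈ G, a * derivSeq Ψ x ∈ 𝒢

namespace IsModelPath

variable {N : ℕ} {𝒜 𝒢 : Set (ℕ → PhaseSpace N →L[ℝ] PhaseSpace N)} {R : ℝ}
  {T G U : Set (PhaseSpace N)} {I : Set ℕ} {V : Set (PhaseSpace N →L[ℝ] PhaseSpace N)}
  {Φ Ψ : ℕ → PhaseSpace N → PhaseSpace N}

/-- Inserting copies of the model near the set `F` where `Φ` is still untouched: a definite
proportion of `F` gets used up, and at most a proportion `θ` of what is used becomes bad. -/
theorem exists_improvement (hM : IsModelPath N 𝒜 𝒢 R T G I V Ψ) {θ : ℝ} (hθ : 0 ≤ θ)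
    (hbad : volume.real (T \ G) ≤ θ * volume.real T) (hU : IsOpen U) (hUb : Bornology.IsBounded U)
    (hΦ : IsSympPath N U Φ) (hΦA : ∀ x, derivSeq Φ x ∈ 𝒜) {F : Set (PhaseSpace N)}
    (hF : MeasurableSet F) (hFU : F ⊆ U) (hF1 : ∀ x ∈ F, derivSeq Φ x = 1) {η : ℝ} (hη : 0 < η) :
    ∃ Φ' F', IsSympPath N U Φ' ∧ (∀ x, derivSeq Φ' x ∈ 𝒜) ∧ MeasurableSet F' ∧ F' ⊆ U ∧
      (∀ x ∈ F', derivSeq Φ' x = 1) ∧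
      volume.real F' ≤
        (1 - volume.real T / volume.real (closedBall (0 : PhaseSpace N) R) / 2) * volume.real F
          + η ∧
      volume.real (U \ (F' ∪ {x | derivSeq Φ' x ∈ 𝒢})) + θ * volume.real F' ≤
        volume.real (U \ (F ∪ {x | derivSeq Φ x ∈ 𝒢})) + θ * volume.real F + (1 + θ) * η := by
  have hfin : ∀ {s : Set (PhaseSpace N)}, s ⊆ U → volume s ≠ ⊤ := fun h =>
    ((measure_mono h).trans_lt hUb.measure_lt_top).ne
  have hTfin : volume T ≠ ⊤ :=
    ((measure_mono hM.subset_closedBall).trans_lt measure_closedBall_lt_top).ne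
  obtain ⟨O, hFO, hO, hOlt⟩ := F.exists_isOpen_lt_of_lt (volume F + ENNReal.ofReal η)
    (ENNReal.lt_add_right (hfin hFU) (by simpa using hη)) (μ := volume)
  set W : Set (PhaseSpace N) := U ∩ O ∩ {x | ∀ i ∈ I, fderiv ℝ (Φ i) x ∈ V} with hWdef
  have hWo : IsOpen W := by
    refine (hU.inter hO).inter ?_
    have : {x | ∀ i ∈ I, fderiv ℝ (Φ i) x ∈ V} = ⋂ i ∈ I, {x | fderiv ℝ (Φ i) x ∈ V} := by
      ext x; simp
    rw [this]
    exact hM.finite.isOpen_biInter fun i _ =>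
      hM.isOpen.preimage ((hΦ.symp i).2.1.continuous_fderiv one_ne_zero)
  have hWU : W ⊆ U := fun x hx => hx.1.1
  have hFW : F ⊆ W := fun x hx => ⟨⟨hFU hx, hFO hx⟩, fun i _ => by
    have : fderiv ℝ (Φ i) x = 1 := congrFun (hF1 x hx) i
    rw [this]; exact hM.one_mem⟩
  have hWF : volume.real (W \ F) ≤ η := by
    have h1 : volume.real W ≤ volume.real F + η := by
      have h2 : volume W ≤ volume F + ENNReal.ofReal η :=
        (measure_mono fun x hx => hx.1.2).trans hOlt.le
      have h3 := ENNReal.toReal_mono (ENNReal.add_ne_top.2 ⟨hfin hFU, ENNReal.ofReal_ne_top⟩) h2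
      rwa [ENNReal.toReal_add (hfin hFU) ENNReal.ofReal_ne_top, ENNReal.toReal_ofReal hη.le] at h3
    rw [measureReal_sdiff hFW hF (hfin hWU)]
    linarith
  obtain ⟨S, r, hr, hdisj, hvol⟩ := exists_finset_closedBall_half_volume hWo (hfin hWU)
  have hR := hM.R_pos
  set ρ : PhaseSpace N → ℝ := fun a => r a / R with hρdef
  have hρR : ∀ a, ρ a * R = r a := fun a => div_mul_cancel₀ _ hR.ne'
  have hρ : ∀ a ∈ S, 0 < ρ a := fun a ha => div_pos (hr a ha).1 hR
  obtain ⟨Φ', hΦ', hout, hin⟩ := hΦ.exists_comp_rescale hM.path hM.subset_closedBall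
    hM.derivSeq_eq_one S ρ hρ (fun a ha => by rw [hρR]; exact (hr a ha).2.trans hWU)
    (by simpa only [hρR] using hdisj)
  simp only [hρR] at hin
  have hcopyball : ∀ a ∈ S, rescaleSet a (ρ a) T ⊆ closedBall a (r a) := by
    intro a ha
    rw [← hρR a, ← rescaleSet_closedBall a (hρ a ha)]
    exact fun x hx => hM.subset_closedBall hx
  have hcopydisj : (S : Set (PhaseSpace N)).PairwiseDisjoint fun a => rescaleSet a (ρ a) T :=
    fun a ha b hb hab => (hdisj ha hb hab).mono (hcopyball a ha) (hcopyball b hb)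
  set W' : Set (PhaseSpace N) := ⋃ a ∈ S, rescaleSet a (ρ a) T with hW'def
  have hW'm : MeasurableSet W' := Finset.measurableSet_biUnion S fun a _ =>
    measurableSet_rescaleSet hM.measurableSet a (ρ a)
  have hW'W : W' ⊆ W := iUnion₂_subset fun a ha => (hcopyball a ha).trans (hr a ha).2
  set W'' : Set (PhaseSpace N) := ⋃ a ∈ S, rescaleSet a (ρ a) (T \ G) with hW''def
  have hW''W' : W'' ⊆ W' := iUnion₂_mono fun a _ x hx => hx.1
  have hball_vol : ∀ a ∈ S, volume.real (closedBall a (r a)) =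
      ρ a ^ (N + N) * volume.real (closedBall (0 : PhaseSpace N) R) := by
    intro a ha
    rw [← hρR a, ← rescaleSet_closedBall a (hρ a ha), volume_real_rescaleSet _ a (hρ a ha)]
  have hW'vol : volume.real W' = (∑ a ∈ S, ρ a ^ (N + N)) * volume.real T := by
    rw [hW'def, measureReal_biUnion_finset hcopydisj
      (fun a _ => measurableSet_rescaleSet hM.measurableSet a (ρ a))
      (fun a ha => ((measure_mono (hcopyball a ha)).trans_lt measure_closedBall_lt_top).ne),
      Finset.sum_mul]
    exact Finset.sum_congr rfl fun a ha => volume_real_rescaleSet T a (hρ a ha)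
  have hsum0 : 0 ≤ ∑ a ∈ S, ρ a ^ (N + N) :=
    Finset.sum_nonneg fun a ha => pow_nonneg (hρ a ha).le _
  have hW''vol : volume.real W'' ≤ θ * volume.real W' := by
    calc volume.real W'' ≤ ∑ a ∈ S, volume.real (rescaleSet a (ρ a) (T \ G)) :=
          measureReal_biUnion_finset_le _ _
      _ = (∑ a ∈ S, ρ a ^ (N + N)) * volume.real (T \ G) := by
          rw [Finset.sum_mul]
          exact Finset.sum_congr rfl fun a ha => volume_real_rescaleSet _ a (hρ a ha)
      _ ≤ (∑ a ∈ S, ρ a ^ (N + N)) * (θ * volume.real T) := by gcongr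
      _ = θ * volume.real W' := by rw [hW'vol]; ring
  have hBpos : 0 < volume.real (closedBall (0 : PhaseSpace N) R) :=
    ENNReal.toReal_pos (measure_closedBall_pos volume _ hR).ne' measure_closedBall_lt_top.ne
  have hW'ge : volume.real T / volume.real (closedBall (0 : PhaseSpace N) R) / 2 * volume.real F ≤
      volume.real W' := by
    have h1 : volume.real F ≤ volume.real W := measureReal_mono hFW (hfin hWU)
    rw [Finset.sum_congr rfl hball_vol, ← Finset.sum_mul] at hvol
    have h2 : volume.real T / volume.real (closedBall (0 : PhaseSpace N) R) *
        (volume.real F / 2) ≤ volume.real T / volume.real (closedBall (0 : PhaseSpace N) R) *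
        ((∑ a ∈ S, ρ a ^ (N + N)) * volume.real (closedBall (0 : PhaseSpace N) R)) := by
      gcongr
      linarith
    rw [hW'vol]
    calc _ = _ := by ring
      _ ≤ _ := h2
      _ = _ := by field_simp
  have hclose : ∀ a ∈ S, ∀ y : ℕ → PhaseSpace N, (∀ i, y i ∈ closedBall a (r a)) →
      ∀ i ∈ I, fderiv ℝ (Φ i) (y i) ∈ V :=
    fun a ha y hy i hi => ((hr a ha).2 (hy i)).2 i hi
  have hW'eq : ∀ x ∉ W', derivSeq Φ' x = derivSeq Φ x := fun x hx =>
    hout x fun a ha hxa => hx (mem_biUnion (show a ∈ (S : Set _) from ha) hxa)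
  have hsplit : volume.real F = volume.real (F ∩ W') + volume.real (F \ W') :=
    (measureReal_inter_add_sdiff hW'm (hfin hFU)).symm
  have hW'F : volume.real W' ≤ volume.real (F ∩ W') + η := by
    have : W' ⊆ (F ∩ W') ∪ (W \ F) := fun x hx => by
      by_cases hxF : x ∈ F
      · exact Or.inl ⟨hxF, hx⟩
      · exact Or.inr ⟨hW'W hx, hxF⟩
    calc _ ≤ _ := measureReal_mono this
            (hfin (union_subset (inter_subset_left.trans hFU) (sdiff_subset.trans hWU)))
      _ ≤ _ := measureReal_union_le _ _
      _ ≤ _ := by gcongr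
  refine ⟨Φ', F \ W', hΦ', ?_, hF.diff hW'm, sdiff_subset.trans hFU, ?_, ?_, ?_⟩
  · intro x
    by_cases hx : x ∈ W'
    · obtain ⟨a, ha, hxa⟩ := mem_iUnion₂.1 hx
      obtain ⟨y, hy, hxy⟩ := hin a ha x (hcopyball a ha hxa)
      rw [hxy]
      exact hM.mul_mem _ (hclose a ha y hy) _
    · rw [hW'eq x hx]
      exact hΦA x
  · intro x hx
    rw [hW'eq x hx.2, hF1 x hx.1]
  · linarith
  · have hsub : U \ (F \ W' ∪ {x | derivSeq Φ' x ∈ 𝒢}) ⊆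
        U \ (F ∪ {x | derivSeq Φ x ∈ 𝒢}) ∪ (W \ F) ∪ W'' := by
      rintro x ⟨hxU, hx⟩
      by_contra hn
      simp only [mem_union, not_or] at hn hx
      obtain ⟨⟨h1, h2⟩, h3⟩ := hn
      by_cases hxW' : x ∈ W'
      · obtain ⟨a, ha, hxa⟩ := mem_iUnion₂.1 hxW'
        obtain ⟨y, hy, hxy⟩ := hin a ha x (hcopyball a ha hxa)
        have hxG : (ρ a)⁻¹ • (x - a) ∈ G := by
          by_contra hG
          exact h3 (mem_biUnion (show a ∈ (S : Set _) from ha)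
            (show (ρ a)⁻¹ • (x - a) ∈ T \ G from ⟨hxa, hG⟩))
        refine hx.2 ?_
        change derivSeq Φ' x ∈ 𝒢
        rw [hxy]
        exact hM.mul_mem_good _ (hclose a ha y hy) _ hxG
      · have hxF : x ∉ F := fun h => hx.1 ⟨h, hxW'⟩
        refine h1 ⟨hxU, ?_⟩
        rintro (h | h)
        · exact hxF h
        · refine hx.2 ?_
          change derivSeq Φ' x ∈ 𝒢
          rw [hW'eq x hxW']
          exact h
    have hB := calc
      volume.real (U \ (F \ W' ∪ {x | derivSeq Φ' x ∈ 𝒢})) ≤ _ := measureReal_mono hsub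
          (hfin (union_subset (union_subset sdiff_subset (sdiff_subset.trans hWU))
            (hW''W'.trans (hW'W.trans hWU))))
      _ ≤ _ := measureReal_union_le _ _
      _ ≤ _ := add_le_add_left (measureReal_union_le _ _) _
    nlinarith [mul_le_mul_of_nonneg_left hW'F hθ]

/-- Iterating the improvement, a model path with bad proportion `θ` yields, on every bounded open
set, paths with bad proportion arbitrarily close to `θ`. -/
theorem exists_path (hM : IsModelPath N 𝒜 𝒢 R T G I V Ψ) (h1 : 1 ∈ 𝒜)
    (hT : 0 < volume.real T) {θ θ' : ℝ} (hθ : 0 ≤ θ) (hθ' : θ < θ')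
    (hbad : volume.real (T \ G) ≤ θ * volume.real T) (hU : IsOpen U) (hUne : U.Nonempty)
    (hUb : Bornology.IsBounded U) :
    ∃ Φ, IsSympPath N U Φ ∧ (∀ x, derivSeq Φ x ∈ 𝒜) ∧
      volume.real (U \ {x | derivSeq Φ x ∈ 𝒢}) < θ' * volume.real U := by
  have hm : 0 < volume.real U :=
    ENNReal.toReal_pos (hU.measure_pos volume hUne).ne' hUb.measure_lt_top.ne
  have hBpos : 0 < volume.real (closedBall (0 : PhaseSpace N) R) :=
    ENNReal.toReal_pos (measure_closedBall_pos volume _ hM.R_pos).ne'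
      measure_closedBall_lt_top.ne
  set c : ℝ := volume.real T / volume.real (closedBall (0 : PhaseSpace N) R) / 2 with hc
  have hc0 : 0 < c := by positivity
  have hc1 : c ≤ 1 := by
    have : volume.real T ≤ volume.real (closedBall (0 : PhaseSpace N) R) :=
      measureReal_mono hM.subset_closedBall measure_closedBall_lt_top.ne
    have := (div_le_one hBpos).2 this
    rw [hc]
    linarith
  have key : ∀ (k : ℕ) (σ : ℝ), 0 < σ → ∃ Φ F, IsSympPath N U Φ ∧ (∀ x, derivSeq Φ x ∈ 𝒜) ∧
      MeasurableSet F ∧ F ⊆ U ∧ (∀ x ∈ F, derivSeq Φ x = 1) ∧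
      volume.real F ≤ (1 - c) ^ k * volume.real U + σ ∧
      volume.real (U \ (F ∪ {x | derivSeq Φ x ∈ 𝒢})) + θ * volume.real F ≤
        θ * volume.real U + σ := by
    intro k
    induction k with
    | zero =>
      intro σ hσ
      have hid : ∀ x, derivSeq (fun _ => (id : PhaseSpace N → PhaseSpace N)) x = 1 :=
        fun x => funext fun _ => fderiv_id
      refine ⟨fun _ => id, U, .id, fun x => hid x ▸ h1, hU.measurableSet, subset_rfl,
        fun x _ => hid x, by simpa using hσ.le, ?_⟩
      have : U \ (U ∪ {x | derivSeq (fun _ => (id : PhaseSpace N → PhaseSpace N)) x ∈ 𝒢}) = ∅ :=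
        sdiff_eq_empty.2 subset_union_left
      rw [this, measureReal_empty]
      linarith
    | succ k ih =>
      intro σ hσ
      obtain ⟨Φ, F, hΦ, hΦA, hF, hFU, hF1, hFv, hb⟩ := ih (σ / 2) (by linarith)
      obtain ⟨η, hη, hη1⟩ : ∃ η > 0, (1 + θ) * η = σ / 2 := by
        refine ⟨σ / (2 * (1 + θ)), by positivity, ?_⟩
        have : (1 + θ) ≠ 0 := by positivity
        field_simp
      obtain ⟨Φ', F', hΦ', hΦA', hF', hFU', hF1', hFv', hb'⟩ :=
        hM.exists_improvement hθ hbad hU hUb hΦ hΦA hF hFU hF1 hη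
      refine ⟨Φ', F', hΦ', hΦA', hF', hFU', hF1', ?_, by linarith⟩
      have h2 : (1 - c) * volume.real F ≤ (1 - c) * ((1 - c) ^ k * volume.real U + σ / 2) :=
        mul_le_mul_of_nonneg_left hFv (by linarith)
      rw [← hc] at hFv'
      rw [pow_succ]
      nlinarith [mul_pos hc0 hσ, mul_nonneg hθ hη.le]
  obtain ⟨k, hk⟩ := exists_pow_lt_of_lt_one (show 0 < (θ' - θ) / 4 by linarith)
    (show 1 - c < 1 by linarith)
  obtain ⟨Φ, F, hΦ, hΦA, -, hFU, -, hFv, hb⟩ := key k ((θ' - θ) / 4 * volume.real U)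
    (mul_pos (by linarith) hm)
  refine ⟨Φ, hΦ, hΦA, ?_⟩
  have hsub : U \ {x | derivSeq Φ x ∈ 𝒢} ⊆ U \ (F ∪ {x | derivSeq Φ x ∈ 𝒢}) ∪ F := by
    intro x hx
    by_cases hxF : x ∈ F
    · exact Or.inr hxF
    · exact Or.inl ⟨hx.1, fun h => h.elim hxF hx.2⟩
  have h3 := (measureReal_mono hsub ((measure_mono (union_subset sdiff_subset hFU)).trans_lt
    hUb.measure_lt_top).ne).trans (measureReal_union_le (μ := volume) _ _)
  have h4 := mul_lt_mul_of_pos_right hk hm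
  have h5 : 0 ≤ θ * volume.real F := mul_nonneg hθ measureReal_nonneg
  have h6 := mul_pos (show 0 < θ' - θ by linarith) hm
  nlinarith

end IsModelPath

theorem isOpen_setOf_subAngle_map_lt {V : Type*} [NormedAddCommGroup V] [InnerProductSpace ℝ V]
    (E F : Submodule ℝ V) (γ : ℝ) :
    IsOpen {L : V →L[ℝ] V | subAngle (E.map (L : V →ₗ[ℝ] V)) F < γ} := by
  have h : ∀ L : V →L[ℝ] V, subAngle (E.map (L : V →ₗ[ℝ] V)) F < γ ↔
      Real.pi / 2 < γ ∨ ∃ v ∈ E, L v ≠ 0 ∧ ∃ w ∈ F, w ≠ 0 ∧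
        InnerProductGeometry.angle (L v) w < γ := by
    intro L
    rw [subAngle, csInf_lt_iff ?_ ⟨Real.pi / 2, Set.mem_union_left _ (mem_singleton _)⟩]
    · constructor
      · rintro ⟨θ, rfl | ⟨v', ⟨v, hv, rfl⟩, hv0, w, hw, hw0, rfl⟩, hθ⟩
        · exact Or.inl hθ
        · exact Or.inr ⟨v, hv, hv0, w, hw, hw0, hθ⟩
      · rintro (hθ | ⟨v, hv, hv0, w, hw, hw0, hθ⟩)
        · exact ⟨_, Or.inl rfl, hθ⟩
        · exact ⟨_, Or.inr ⟨L v, ⟨v, hv, rfl⟩, hv0, w, hw, hw0, rfl⟩, hθ⟩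
    · refine ⟨0, ?_⟩
      rintro θ (rfl | ⟨v, -, -, w, -, -, rfl⟩)
      · positivity
      · exact InnerProductGeometry.angle_nonneg _ _
  simp only [h]
  by_cases hγ : Real.pi / 2 < γ
  · simp [hγ]
  · simp only [hγ, false_or]
    rw [isOpen_iff_mem_nhds]
    rintro L ⟨v, hv, hv0, w, hw, hw0, hlt⟩
    have hc : ContinuousAt (fun M : V →L[ℝ] V => M v) L := by fun_prop
    have hc2 : ContinuousAt (fun M : V →L[ℝ] V => InnerProductGeometry.angle (M v) w) L :=
      ContinuousAt.comp (f := fun M : V →L[ℝ] V => (M v, w))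
        (g := fun p : V × V => InnerProductGeometry.angle p.1 p.2)
        (InnerProductGeometry.continuousAt_angle hv0 hw0) (hc.prodMk continuousAt_const)
    filter_upwards [hc.eventually_ne hv0, hc2.eventually_lt_const hlt] with M h1 h2
    exact ⟨v, hv, h1, w, hw, hw0, h2⟩

theorem exists_nhds_one_mul_mem_of_isCompact {M : Type*} [Monoid M] [TopologicalSpace M]
    [ContinuousMul M] {K O : Set (ℕ → M)} (hK : IsCompact K) (hO : IsOpen O) (hKO : K ⊆ O) :
    ∃ (I : Set ℕ) (V : Set M), I.Finite ∧ IsOpen V ∧ 1 ∈ V ∧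
      ∀ a : ℕ → M, (∀ i ∈ I, a i ∈ V) → ∀ k ∈ K, a * k ∈ O := by
  obtain ⟨u, v, hu, -, h1u, hKv, huv⟩ := generalized_tube_lemma
    (isCompact_singleton (x := (1 : ℕ → M))) hK (hO.preimage continuous_mul) (by
      rintro ⟨a, k⟩ ⟨ha, hk⟩
      obtain rfl : a = 1 := ha
      simpa using hKO hk)
  have hmem : u ∈ 𝓝 (1 : ℕ → M) := hu.mem_nhds (h1u rfl)
  rw [nhds_pi, Filter.mem_pi] at hmem
  obtain ⟨I, hI, t, ht, htu⟩ := hmem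
  refine ⟨I, ⋂ i ∈ I, interior (t i), hI, hI.isOpen_biInter fun _ _ => isOpen_interior,
    mem_iInter₂.2 fun i _ => mem_interior_iff_mem_nhds.2 (ht i), ?_⟩
  intro a ha k hk
  exact huv (mk_mem_prod
    (htu fun i hi => interior_subset (mem_iInter₂.1 (ha i hi) i hi)) (hKv hk))

/-- The composition `A (i-1) ∘ ⋯ ∘ A 0` as a linear equivalence. -/
def chainEquiv {N : ℕ} (A : ℕ → PhaseSpace N ≃ₗ[ℝ] PhaseSpace N) :
    ℕ → PhaseSpace N ≃ₗ[ℝ] PhaseSpace N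
  | 0 => LinearEquiv.refl ℝ _
  | i + 1 => (chainEquiv A i).trans (A i)

section chain

variable {N n : ℕ} {A : ℕ → PhaseSpace N ≃ₗ[ℝ] PhaseSpace N}

theorem chainEquiv_succ_apply (i : ℕ) (x : PhaseSpace N) :
    chainEquiv A (i + 1) x = A i (chainEquiv A i x) := rfl

theorem coe_chainEquiv (i : ℕ) :
    chain (fun j => (A j : PhaseSpace N → PhaseSpace N)) i = chainEquiv A i := by
  induction i with
  | zero => rfl
  | succ i ih => rw [chain, ih]; rfl

theorem isSymplectomorph_chainEquiv
    (hA : ∀ i < n, ∀ v w, stdSymp N (A i v) (A i w) = stdSymp N v w) {i : ℕ} (hi : i ≤ n) :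
    IsSymplectomorph N (chainEquiv A i) := by
  refine .of_linearEquiv _ ?_
  induction i with
  | zero => intro v w; rfl
  | succ i ih =>
    intro v w
    rw [chainEquiv_succ_apply, chainEquiv_succ_apply, hA i hi, ih (Nat.le_of_succ_le hi)]

theorem isSymplectomorph_chainEquiv_symm
    (hA : ∀ i < n, ∀ v w, stdSymp N (A i v) (A i w) = stdSymp N v w) {i : ℕ} (hi : i ≤ n) :
    IsSymplectomorph N (chainEquiv A i).symm := by
  have h := isSymplectomorph_chainEquiv hA hi
  convert h.invFun
  funext x
  refine (chainEquiv A i).injective ?_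
  rw [LinearEquiv.apply_symm_apply, h.rightInverse x]

theorem isSymplectomorph_chain {g : ℕ → PhaseSpace N → PhaseSpace N}
    (hg : ∀ i < n, IsSymplectomorph N (g i)) {i : ℕ} (hi : i ≤ n) :
    IsSymplectomorph N (chain g i) := by
  induction i with
  | zero => exact .id
  | succ i ih => exact (hg i hi).comp (ih (Nat.le_of_succ_le hi))

/-- `chainEquiv` as a continuous linear equivalence. -/
def chainCLE (A : ℕ → PhaseSpace N ≃ₗ[ℝ] PhaseSpace N) (i : ℕ) :
    PhaseSpace N ≃L[ℝ] PhaseSpace N :=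
  (chainEquiv A i).toContinuousLinearEquiv

/-- The derivative sequences allowed by the closeness condition on the maps `A i⁻¹ ∘ g i`, in the
coordinates transported to time `0`. -/
def admissibleDerivs (A : ℕ → PhaseSpace N ≃ₗ[ℝ] PhaseSpace N) (n : ℕ) (ε : ℝ) :
    Set (ℕ → PhaseSpace N →L[ℝ] PhaseSpace N) :=
  {a | ∀ i < n, IsUnit (a i) ∧
    ‖(chainCLE A i : PhaseSpace N →L[ℝ] PhaseSpace N) * (a (i + 1) * Ring.inverse (a i)) *
      ((chainCLE A i).symm : PhaseSpace N →L[ℝ] PhaseSpace N) - 1‖ < ε}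

/-- The derivative sequences bringing `E` to within angle `γ` of `F` at time `n`. -/
def bendingDerivs (A : ℕ → PhaseSpace N ≃ₗ[ℝ] PhaseSpace N) (n : ℕ)
    (E F : Submodule ℝ (PhaseSpace N)) (γ : ℝ) : Set (ℕ → PhaseSpace N →L[ℝ] PhaseSpace N) :=
  {a | subAngle (E.map (((chainCLE A n : PhaseSpace N →L[ℝ] PhaseSpace N) * a n :
    PhaseSpace N →L[ℝ] PhaseSpace N) : PhaseSpace N →ₗ[ℝ] PhaseSpace N)) F < γ}

theorem isOpen_admissibleDerivs (ε : ℝ) : IsOpen (admissibleDerivs A n ε) := by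
  have h : admissibleDerivs A n ε = ⋂ i ∈ Iio n,
      ({a : ℕ → PhaseSpace N →L[ℝ] PhaseSpace N | IsUnit (a i)} ∩
        (fun a => ‖(chainCLE A i : PhaseSpace N →L[ℝ] PhaseSpace N) *
          (a (i + 1) * Ring.inverse (a i)) *
          ((chainCLE A i).symm : PhaseSpace N →L[ℝ] PhaseSpace N) - 1‖) ⁻¹' Iio ε) := by
    ext a
    simp [admissibleDerivs]
  rw [h]
  refine (finite_Iio n).isOpen_biInter fun i _ => ?_
  have happly : Continuous fun a : ℕ → PhaseSpace N →L[ℝ] PhaseSpace N => a i :=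
    continuous_apply i
  have hunits : IsOpen {a : ℕ → PhaseSpace N →L[ℝ] PhaseSpace N | IsUnit (a i)} :=
    Units.isOpen.preimage happly
  refine ContinuousOn.isOpen_inter_preimage ?_ hunits isOpen_Iio
  intro a ha
  obtain ⟨u, hu⟩ := ha
  have hinv : ContinuousAt (fun b : ℕ → PhaseSpace N →L[ℝ] PhaseSpace N => Ring.inverse (b i)) a :=
    ContinuousAt.comp (g := Ring.inverse) (by rw [← hu]; exact NormedRing.inverse_continuousAt u)
      happly.continuousAt
  exact ((((continuousAt_const.mul ((continuous_apply (i + 1)).continuousAt.mul hinv)).mul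
    continuousAt_const).sub continuousAt_const).norm).continuousWithinAt

theorem isOpen_bendingDerivs (E F : Submodule ℝ (PhaseSpace N)) (γ : ℝ) :
    IsOpen (bendingDerivs A n E F γ) := by
  have happly : Continuous fun a : ℕ → PhaseSpace N →L[ℝ] PhaseSpace N =>
      (chainCLE A n : PhaseSpace N →L[ℝ] PhaseSpace N) * a n :=
    continuous_const.mul (continuous_apply n)
  exact (isOpen_setOf_subAngle_map_lt E F γ).preimage happly

theorem one_mem_admissibleDerivs {ε : ℝ} (hε : 0 < ε) : 1 ∈ admissibleDerivs A n ε := by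
  intro i _
  have h : (chainCLE A i : PhaseSpace N →L[ℝ] PhaseSpace N) *
      ((chainCLE A i).symm : PhaseSpace N →L[ℝ] PhaseSpace N) = 1 :=
    (chainCLE A i).coe_comp_coe_symm
  refine ⟨isUnit_one, ?_⟩
  simp [h, hε]

theorem fderiv_comp_chainEquiv {f : PhaseSpace N → PhaseSpace N} {x : PhaseSpace N} (i : ℕ) :
    fderiv ℝ (chainEquiv A i ∘ f) x =
      (chainCLE A i : PhaseSpace N →L[ℝ] PhaseSpace N) * fderiv ℝ f x :=
  (chainCLE A i).comp_fderiv (f := f) (x := x)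

/-- The derivative of `A i⁻¹ ∘ g i` in terms of the derivatives of a path `Φ` such that
`chain g i = chainEquiv A i ∘ Φ i`. -/
theorem fderiv_symm_comp_of_chain_eq {g Φ : ℕ → PhaseSpace N → PhaseSpace N} {i : ℕ}
    (h0 : IsSymplectomorph N (Φ i)) (h1 : IsSymplectomorph N (Φ (i + 1)))
    (hi : chain g i = chainEquiv A i ∘ Φ i)
    (hi1 : chain g (i + 1) = chainEquiv A (i + 1) ∘ Φ (i + 1)) (x : PhaseSpace N) :
    fderiv ℝ (fun y => (A i).symm (g i y)) (chain g i x) =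
      (chainCLE A i : PhaseSpace N →L[ℝ] PhaseSpace N) *
        (derivSeq Φ x (i + 1) * Ring.inverse (derivSeq Φ x i)) *
        ((chainCLE A i).symm : PhaseSpace N →L[ℝ] PhaseSpace N) := by
  have hcomp : (fun y => (A i).symm (g i y)) =
      (chainEquiv A i ∘ Φ (i + 1)) ∘ (Function.invFun (Φ i) ∘ (chainCLE A i).symm) := by
    funext y
    obtain ⟨z, hz⟩ := h0.1.2 ((chainCLE A i).symm y)
    have hy : y = chain g i z := by
      rw [hi, Function.comp_apply, hz]
      exact ((chainCLE A i).apply_symm_apply y).symm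
    have h2 : g i y = chainEquiv A (i + 1) (Φ (i + 1) z) := by
      rw [hy]; exact congrFun hi1 z
    simp only [Function.comp_apply]
    rw [h2, ← hz, h0.leftInverse z, chainEquiv_succ_apply, LinearEquiv.symm_apply_apply]
  have hx : (chainCLE A i).symm (chain g i x) = Φ i x := by
    rw [hi]; exact (chainCLE A i).symm_apply_apply _
  have hd2 : DifferentiableAt ℝ (Function.invFun (Φ i)) ((chainCLE A i).symm (chain g i x)) :=
    h0.differentiableAt_invFun _
  have hd3 : DifferentiableAt ℝ (Function.invFun (Φ i) ∘ (chainCLE A i).symm) (chain g i x) :=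
    hd2.comp _ (chainCLE A i).symm.differentiableAt
  have hx2 : (Function.invFun (Φ i) ∘ (chainCLE A i).symm) (chain g i x) = x := by
    rw [Function.comp_apply, hx, h0.leftInverse x]
  have hd1 : DifferentiableAt ℝ (chainEquiv A i ∘ Φ (i + 1)) x :=
    (chainCLE A i).differentiableAt.comp _ (h1.differentiableAt _)
  rw [hcomp, fderiv_comp _ (by rw [hx2]; exact hd1) hd3, hx2,
    fderiv_comp_chainEquiv i,
    fderiv_comp _ hd2 (chainCLE A i).symm.differentiableAt, hx, (chainCLE A i).symm.fderiv]
  rw [derivSeq, derivSeq, h0.inverse_fderiv]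
  rfl

end chain

section FlexWitness

variable {N n : ℕ} {A : ℕ → PhaseSpace N ≃ₗ[ℝ] PhaseSpace N}
  {E1 E2 : ℕ → Submodule ℝ (PhaseSpace N)} {ε κ γ : ℝ} {U : Set (PhaseSpace N)}

/-- A flexibility witness, transported to time `0`. -/
theorem FlexWitness.exists_isSympPath
    (hA : ∀ i < n, ∀ v w, stdSymp N (A i v) (A i w) = stdSymp N v w)
    (h : FlexWitness N n A E1 E2 ε κ U γ) :
    ∃ Φ, IsSympPath N U Φ ∧ (∀ x, derivSeq Φ x ∈ admissibleDerivs A n ε) ∧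
      ∃ G ⊆ U, MeasurableSet G ∧ ENNReal.ofReal (1 - κ) * volume U < volume G ∧
        ∀ x ∈ G, derivSeq Φ x ∈ bendingDerivs A n (E1 0) (E2 n) γ := by
  obtain ⟨g, hg, hout, hε, G, hGU, hGm, hGv, hG⟩ := h
  simp only [coe_chainEquiv] at hout
  set Φ : ℕ → PhaseSpace N → PhaseSpace N :=
    fun i => if i ≤ n then (chainEquiv A i).symm ∘ chain g i else id with hΦdef
  have hΦi : ∀ i ≤ n, Φ i = (chainEquiv A i).symm ∘ chain g i := fun i hi => if_pos hi
  have hchain : ∀ i ≤ n, chain g i = chainEquiv A i ∘ Φ i := fun i hi => by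
    rw [hΦi i hi]
    funext x
    simp
  have hfix : ∀ i ≤ n, ∀ x ∉ U, chain g i x = chainEquiv A i x := by
    intro i
    induction i with
    | zero => intro _ x _; rfl
    | succ i ih =>
      intro hi x hx
      rw [chain, Function.comp_apply, ih (Nat.le_of_succ_le hi) x hx, hout i hi]
      · rfl
      · rintro ⟨y, hy, hyx⟩
        exact hx ((chainEquiv A i).injective hyx ▸ hy)
  have hsymp : ∀ i, IsSymplectomorph N (Φ i) := by
    intro i
    by_cases hi : i ≤ n
    · rw [hΦi i hi]
      exact (isSymplectomorph_chainEquiv_symm hA hi).comp (isSymplectomorph_chain hg hi)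
    · rw [hΦdef]
      simp only [if_neg hi]
      exact .id
  refine ⟨Φ, ⟨hsymp, hΦi 0 n.zero_le, ?_⟩, ?_, G, hGU, hGm, hGv, ?_⟩
  · intro i x hx
    by_cases hi : i ≤ n
    · rw [hΦi i hi, Function.comp_apply, hfix i hi x hx, LinearEquiv.symm_apply_apply]
    · simp [hΦdef, hi]
  · intro x i hi
    refine ⟨(hsymp i).isUnit_fderiv x, ?_⟩
    rw [← fderiv_symm_comp_of_chain_eq (hsymp i) (hsymp (i + 1)) (hchain i hi.le)
      (hchain (i + 1) hi) x]
    exact hε i hi _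
  · intro x hx
    have := hG x hx
    rwa [hchain n le_rfl, fderiv_comp_chainEquiv n] at this

/-- A path of symplectomorphisms at time `0` gives a flexibility witness. -/
theorem IsSympPath.flexWitness {Φ : ℕ → PhaseSpace N → PhaseSpace N}
    (hA : ∀ i < n, ∀ v w, stdSymp N (A i v) (A i w) = stdSymp N v w)
    (hΦ : IsSympPath N U Φ) (hadm : ∀ x, derivSeq Φ x ∈ admissibleDerivs A n ε)
    (hU : IsOpen U) (hUb : Bornology.IsBounded U)
    (hvol : volume.real (U \ {x | derivSeq Φ x ∈ bendingDerivs A n (E1 0) (E2 n) γ}) <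
      min κ 1 * volume.real U) :
    FlexWitness N n A E1 E2 ε κ U γ := by
  set g : ℕ → PhaseSpace N → PhaseSpace N := fun i =>
    (chainEquiv A (i + 1) ∘ Φ (i + 1)) ∘ (Function.invFun (Φ i) ∘ (chainEquiv A i).symm) with hg
  have hchain : ∀ i, chain g i = chainEquiv A i ∘ Φ i := by
    intro i
    induction i with
    | zero => rw [hΦ.zero]; rfl
    | succ i ih =>
      rw [chain, ih]
      funext x
      simp [hg, (hΦ.symp i).leftInverse x]
  refine ⟨g, ?_, ?_, ?_, U ∩ {x | derivSeq Φ x ∈ bendingDerivs A n (E1 0) (E2 n) γ},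
    inter_subset_left, ?_, ?_, ?_⟩
  · intro i hi
    exact ((isSymplectomorph_chainEquiv hA hi).comp (hΦ.symp _)).comp
      ((hΦ.symp i).invFun.comp (isSymplectomorph_chainEquiv_symm hA hi.le))
  · intro i _ x hx
    rw [coe_chainEquiv] at hx
    have hu : (chainEquiv A i).symm x ∉ U := fun h => hx ⟨_, h, by simp⟩
    have h1 : Function.invFun (Φ i) ((chainEquiv A i).symm x) = (chainEquiv A i).symm x := by
      conv_lhs => rw [← hΦ.eq_self i _ hu]
      exact (hΦ.symp i).leftInverse _
    simp only [hg, Function.comp_apply]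
    rw [h1, hΦ.eq_self _ _ hu, chainEquiv_succ_apply, LinearEquiv.apply_symm_apply]
  · intro i hi x
    obtain ⟨z, hz⟩ := (hΦ.symp i).1.2 ((chainEquiv A i).symm x)
    have hx : x = chain g i z := by
      rw [hchain, Function.comp_apply, hz, LinearEquiv.apply_symm_apply]
    rw [hx, fderiv_symm_comp_of_chain_eq (hΦ.symp i) (hΦ.symp (i + 1)) (hchain i)
      (hchain (i + 1)) z]
    exact (hadm z i hi).2
  · exact hU.measurableSet.inter
      ((isOpen_bendingDerivs _ _ _).preimage hΦ.continuous_derivSeq).measurableSet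
  · have hfin : volume U ≠ ⊤ := hUb.measure_lt_top.ne
    have hmeas := ((isOpen_bendingDerivs (A := A) (n := n) (E1 0) (E2 n) γ).preimage
      hΦ.continuous_derivSeq).measurableSet
    have h1 : volume.real (U ∩ {x | derivSeq Φ x ∈ bendingDerivs A n (E1 0) (E2 n) γ}) +
        volume.real (U \ {x | derivSeq Φ x ∈ bendingDerivs A n (E1 0) (E2 n) γ}) =
        volume.real U := measureReal_inter_add_sdiff hmeas hfin
    have h2 : (1 - min κ 1) * volume.real U <
        volume.real (U ∩ {x | derivSeq Φ x ∈ bendingDerivs A n (E1 0) (E2 n) γ}) := by linarith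
    have h3 : 0 ≤ 1 - min κ 1 := sub_nonneg.2 (min_le_right _ _)
    calc ENNReal.ofReal (1 - κ) * volume U
        ≤ ENNReal.ofReal (1 - min κ 1) * volume U := by
          gcongr
          exact min_le_left _ _
      _ = ENNReal.ofReal ((1 - min κ 1) * volume.real U) := by
          rw [ENNReal.ofReal_mul h3, ofReal_measureReal hfin]
      _ < ENNReal.ofReal
          (volume.real (U ∩ {x | derivSeq Φ x ∈ bendingDerivs A n (E1 0) (E2 n) γ})) :=
          (ENNReal.ofReal_lt_ofReal_iff_of_nonneg (mul_nonneg h3 measureReal_nonneg)).2 h2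
      _ = _ := ofReal_measureReal ((measure_mono inter_subset_left).trans_lt
          hUb.measure_lt_top).ne
  · intro x hx
    rw [hchain n, fderiv_comp_chainEquiv n]
    exact hx.2

end FlexWitness

/-- A path supported in a bounded open set `U` and good over a compact set `C ⊆ U` gives a model
path whose support has the same volume as `U`. -/
theorem IsSympPath.exists_isModelPath {N : ℕ} {𝒜 𝒢 : Set (ℕ → PhaseSpace N →L[ℝ] PhaseSpace N)}
    {U C : Set (PhaseSpace N)} {Φ : ℕ → PhaseSpace N → PhaseSpace N} (hΦ : IsSympPath N U Φ)
    (hU : IsOpen U) (hUb : Bornology.IsBounded U) (hC : IsCompact C) (hCU : C ⊆ U)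
    (h𝒜 : IsOpen 𝒜) (h𝒢 : IsOpen 𝒢) (h1 : 1 ∈ 𝒜) (hΦ𝒜 : ∀ x, derivSeq Φ x ∈ 𝒜)
    (hΦ𝒢 : ∀ x ∈ C, derivSeq Φ x ∈ 𝒢) :
    ∃ R T I V, IsModelPath N 𝒜 𝒢 R T C I V Φ ∧ volume T = volume U := by
  obtain ⟨R, hR, hUR⟩ := hUb.subset_closedBall_lt 0 0
  have hfar : ∀ x ∉ closedBall (0 : PhaseSpace N) R, derivSeq Φ x = 1 := by
    intro x hx
    funext i
    have : Φ i =ᶠ[𝓝 x] id := by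
      filter_upwards [isClosed_closedBall.isOpen_compl.mem_nhds hx] with y hy
      exact hΦ.eq_self i y fun h => hy (hUR h)
    exact this.fderiv_eq.trans fderiv_id
  have hopen : IsOpen {x | derivSeq Φ x ≠ 1} := isOpen_ne.preimage hΦ.continuous_derivSeq
  obtain ⟨I, V, hI, hV, h1V, hIV⟩ := exists_nhds_one_mul_mem_of_isCompact
    (((isCompact_closedBall (0 : PhaseSpace N) R).image hΦ.continuous_derivSeq).insert 1) h𝒜 (by
      rintro a (rfl | ⟨x, -, rfl⟩)
      · exact h1
      · exact hΦ𝒜 x)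
  obtain ⟨I', V', hI', hV', h1V', hIV'⟩ := exists_nhds_one_mul_mem_of_isCompact
    (hC.image hΦ.continuous_derivSeq) h𝒢 (by
      rintro a ⟨x, hx, rfl⟩
      exact hΦ𝒢 x hx)
  refine ⟨R, U ∪ {x | derivSeq Φ x ≠ 1}, I ∪ I', V ∩ V', ?_, ?_⟩
  · refine ⟨hΦ.mono subset_union_left, hR, union_subset hUR fun x hx => ?_,
      (hU.union hopen).measurableSet, hC.measurableSet, hCU.trans subset_union_left,
      fun x hx => ?_, hI.union hI', hV.inter hV', ⟨h1V, h1V'⟩, ?_, ?_⟩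
    · by_contra h
      exact hx (hfar x h)
    · by_contra h
      exact hx (Or.inr h)
    · intro a ha x
      refine hIV a (fun i hi => (ha i (Or.inl hi)).1) _ ?_
      by_cases hx : x ∈ closedBall (0 : PhaseSpace N) R
      · exact Or.inr ⟨x, hx, rfl⟩
      · exact Or.inl (hfar x hx)
    · intro a ha x hx
      exact hIV' a (fun i hi => (ha i (Or.inr hi)).2) _ ⟨x, hx, rfl⟩
  · refine measure_congr (union_ae_eq_left_iff_ae_subset.2 ?_)
    have hae : ∀ᵐ x, ∀ i, x ∈ Uᶜ → fderiv ℝ (Φ i) x = 1 := ae_all_iff.2 fun i =>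
      ae_fderiv_eq_one_of_fixed (hΦ.symp i).differentiableAt hU.isClosed_compl.measurableSet
        (hΦ.eq_self i)
    filter_upwards [hae] with x hx hx1
    by_contra hxU
    exact hx1 (funext fun i => hx i hxU)

/-- If a split sequence of length `n` is `(ε,κ/2)`-flexible,
then for ANY nonempty bounded open set `U ⊆ ℝ^{2N}` and any `γ > 0` there are
symplectomorphisms `g 0, …, g (n-1)` satisfying the three conditions in the
definition of `(ε,κ)`-flexibility with this `U` and this `γ`. -/
theorem stmt_13 (N n : ℕ) (hN : 0 < N)
    (A : ℕ → EuclideanSpace ℝ (Fin (N + N)) ≃ₗ[ℝ] EuclideanSpace ℝ (Fin (N + N)))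
    (E1 E2 : ℕ → Submodule ℝ (EuclideanSpace ℝ (Fin (N + N))))
    (hsplit : IsSplitSeq N n A E1 E2)
    (ε κ : ℝ) (hε : 0 < ε) (hκ : 0 < κ)
    (hflex : IsFlexible N n A E1 E2 ε (κ / 2)) :
    ∀ U : Set (EuclideanSpace ℝ (Fin (N + N))),
      U.Nonempty → IsOpen U → Bornology.IsBounded U →
      ∀ γ > (0:ℝ), FlexWitness N n A E1 E2 ε κ U γ := by
  intro U hUne hU hUb γ hγ
  obtain ⟨U₀, hU₀, hU₀b, h0, hwit⟩ := hflex γ hγ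
  obtain ⟨Φ, hΦ, hΦA, G, hGU, hGm, hGv, hG⟩ := hwit.exists_isSympPath hsplit.1
  obtain ⟨C, hCG, hC, hCv⟩ := hGm.exists_lt_isCompact hGv
  obtain ⟨R, T, I, V, hM, hT⟩ := hΦ.exists_isModelPath hU₀ hU₀b hC (hCG.trans hGU)
    (isOpen_admissibleDerivs ε) (isOpen_bendingDerivs (E1 0) (E2 n) γ)
    (one_mem_admissibleDerivs hε) hΦA fun x hx => hG x (hCG hx)
  have hTfin : volume T ≠ ⊤ := by rw [hT]; exact hU₀b.measure_lt_top.ne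
  have hTpos : 0 < volume.real T := by
    rw [measureReal_def, hT]
    exact ENNReal.toReal_pos (hU₀.measure_pos volume ⟨0, h0⟩).ne' hU₀b.measure_lt_top.ne
  have hCfin : volume C ≠ ⊤ := hC.measure_lt_top.ne
  have hCpos : 0 < volume.real C :=
    ENNReal.toReal_pos (pos_of_gt hCv).ne' hCfin
  have hCκ : (1 - κ / 2) * volume.real T < volume.real C := by
    rw [← hT] at hCv
    have h1 := (ENNReal.toReal_lt_toReal hCv.ne_top hCfin).2 hCv
    rw [ENNReal.toReal_mul, ENNReal.toReal_ofReal'] at h1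
    exact (mul_le_mul_of_nonneg_right (le_max_left _ _) measureReal_nonneg).trans_lt h1
  have hdiff : volume.real (T \ C) = volume.real T - volume.real C :=
    measureReal_sdiff hM.good_subset hM.measurableSet_good hTfin
  have hθ : volume.real (T \ C) / volume.real T < min κ 1 := by
    rw [div_lt_iff₀ hTpos, hdiff]
    rcases min_choice κ 1 with h | h <;> rw [h] <;> nlinarith
  obtain ⟨Φ', hΦ', hΦA', hvol⟩ := hM.exists_path (one_mem_admissibleDerivs hε) hTpos
    (by positivity) hθ (div_mul_cancel₀ _ hTpos.ne').ge hU hUne hUb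
  exact hΦ'.flexWitness hsplit.1 hΦA' hU hUb hvol
end
end
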